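/- Preservation of generality by the left-value-free transformation: Let ρ: Π Z. ℓ → r [π] be a left-linear constrained rewrite rule, let ρ̂ = lvf(ρ) be its left-value-free transformation, and let ⟨X, s, ∃x⃗.φ⟩ be an existentially constrained term with Var(ρ̂) ∩ Var(s,φ) = ∅. If ⟨X, s, ∃x⃗.φ⟩ →^p_ρ ⟨Y, t, ∃y⃗.ψ⟩ is a most general rewrite step at position p, then there exists an existentially constrained term ⟨Y', t', ∃y⃗'.ψ'⟩ such that ⟨X, s, ∃x⃗.φ⟩ →^p_{ρ̂} ⟨Y', t', ∃y⃗'.ψ'⟩ and ⟨Y', t', ∃y⃗'.ψ'⟩ ∼ ⟨Y, t, ∃y⃗.ψ⟩. -/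

import Mathlib

namespace LCTRS

open scoped Classical

noncomputable section

/-- First-order terms over function symbols `F` and variables `V`. -/
inductive Term (F V : Type) : Type where
  | var : V → Term F V
  | app : F → List (Term F V) → Term F V

variable {F V D : Type}

/-- Occurrence of a variable in a term. -/
inductive Term.VarIn (x : V) : Term F V → Prop where
  | var : Term.VarIn x (Term.var x)
  | app {f : F} {ts : List (Term F V)} {t : Term F V} :
      t ∈ ts → Term.VarIn x t → Term.VarIn x (Term.app f ts)

/-- The set of variables occurring in a term. -/
def Term.vars (t : Term F V) : Set V := {x | Term.VarIn x t}

/-- Application of a substitution to a term. -/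
def Term.subst (t : Term F V) (σ : V → Term F V) : Term F V :=
  match t with
  | .var x => σ x
  | .app f ts => .app f (ts.attach.map (fun u => u.1.subst σ))
decreasing_by
  have := List.sizeOf_lt_of_mem u.2
  simp only [Term.app.sizeOf_spec] at *
  omega

/-- The domain of a substitution. -/
def substDom (σ : V → Term F V) : Set V := {x | σ x ≠ Term.var x}

/-- Positions in a term. -/
abbrev Pos := List Nat

/-- `SubtermAt s p u`: the subterm of `s` at position `p` exists and equals `u`. -/
inductive SubtermAt : Term F V → Pos → Term F V → Prop where
  | refl (t : Term F V) : SubtermAt t [] t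
  | app {f : F} {ts : List (Term F V)} {i : Nat} {t u : Term F V} {p : Pos} :
      ts[i]? = some t → SubtermAt t p u → SubtermAt (Term.app f ts) (i :: p) u

/-- `ReplaceAt s p u t`: replacing the subterm of `s` at position `p` by `u` yields `t`. -/
inductive ReplaceAt : Term F V → Pos → Term F V → Term F V → Prop where
  | here (t u : Term F V) : ReplaceAt t [] u u
  | app {f : F} {ts : List (Term F V)} {i : Nat} {p : Pos} {u t t' : Term F V} :
      ts[i]? = some t → ReplaceAt t p u t' →
      ReplaceAt (Term.app f ts) (i :: p) u (Term.app f (ts.set i t'))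

/-- Replacement at a list of pairwise parallel positions (performed sequentially). -/
inductive ReplaceList : Term F V → List Pos → List (Term F V) → Term F V → Prop where
  | nil (t : Term F V) : ReplaceList t [] [] t
  | cons {t t₁ t₂ : Term F V} {p : Pos} {ps : List Pos} {u : Term F V} {us : List (Term F V)} :
      ReplaceAt t p u t₁ → ReplaceList t₁ ps us t₂ → ReplaceList t (p :: ps) (u :: us) t₂

/-- A term is linear if each variable occurs at most once in it. -/
def Term.Linear (t : Term F V) : Prop :=
  ∀ (x : V) (p q : Pos), SubtermAt t p (Term.var x) → SubtermAt t q (Term.var x) → p = q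

/-- A term is `X`-linear if each variable of `X` occurs at most once in it. -/
def Term.LinearOn (t : Term F V) (X : Set V) : Prop :=
  ∀ x ∈ X, ∀ (p q : Pos), SubtermAt t p (Term.var x) → SubtermAt t q (Term.var x) → p = q

/-- A model over the (theory part of the) signature: an interpretation of the function
symbols over a domain `D`, a designated truth value, a set `Val` of value constants such
that every domain element is denoted by some value, and designated conjunction, equality
and truth symbols interpreted as expected. -/
structure Model (F V D : Type) where
  interp : F → List D → D
  tval : D
  Val : Set F
  andSym : F
  eqSym : F
  trueSym : F
  val_const : ∀ v ∈ Val, ∀ ds : List D, interp v ds = interp v []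
  val_surj : ∀ d : D, ∃ v ∈ Val, interp v [] = d
  and_spec : ∀ a b : D, (interp andSym [a, b] = tval ↔ (a = tval ∧ b = tval))
  eq_spec : ∀ a b : D, (interp eqSym [a, b] = tval ↔ a = b)
  true_spec : interp trueSym [] = tval

/-- Evaluation of a term in a model under a valuation. -/
def Model.eval (M : Model F V D) (ξ : V → D) (t : Term F V) : D :=
  match t with
  | .var x => ξ x
  | .app f ts => M.interp f (ts.attach.map (fun u => M.eval ξ u.1))
decreasing_by
  have := List.sizeOf_lt_of_mem u.2
  simp only [Term.app.sizeOf_spec] at *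
  omega

/-- A constraint holds in `M` under the valuation `ξ`. -/
def Model.holds (M : Model F V D) (ξ : V → D) (φ : Term F V) : Prop := M.eval ξ φ = M.tval

/-- `⊨_M φ`: the constraint `φ` holds under every valuation. -/
def Model.validC (M : Model F V D) (φ : Term F V) : Prop := ∀ ξ : V → D, M.holds ξ φ

/-- `t` is a value (a constant from `Val`). -/
def Model.IsValueTerm (M : Model F V D) (t : Term F V) : Prop := ∃ v ∈ M.Val, t = Term.app v []

/-- The root symbol of `t` is a value symbol. -/
def Model.IsValueSym (M : Model F V D) (t : Term F V) : Prop :=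
  ∃ v ∈ M.Val, ∃ ts : List (Term F V), t = Term.app v ts

/-- No value occurs in `t`. -/
def Term.ValueFree (t : Term F V) (M : Model F V D) : Prop :=
  ∀ (p : Pos) (u : Term F V), SubtermAt t p u → ¬ M.IsValueSym u

/-- The conjunction `φ ∧ ψ` as a constraint. -/
def Model.conj (M : Model F V D) (φ ψ : Term F V) : Term F V := Term.app M.andSym [φ, ψ]

/-- The equation `s = t` as a constraint. -/
def Model.eqc (M : Model F V D) (s t : Term F V) : Term F V := Term.app M.eqSym [s, t]

/-- The constraint `true`. -/
def Model.trueC (M : Model F V D) : Term F V := Term.app M.trueSym []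

/-- `φ ∧ ψ₁ ∧ ⋯ ∧ ψₙ`. -/
def Model.conjFrom (M : Model F V D) (φ : Term F V) (l : List (Term F V)) : Term F V :=
  l.foldl M.conj φ

/-- `ψ₁ ∧ ⋯ ∧ ψₙ`. -/
def Model.bigConj (M : Model F V D) (l : List (Term F V)) : Term F V :=
  l.foldl M.conj M.trueC

/-- An existential constraint `⟨∃x⃗. φ⟩`: a set of (bound) variables together with a
constraint. -/
structure EC (F V : Type) where
  bvars : Set V
  constr : Term F V

/-- Well-formedness of an existential constraint: `{x⃗} ⊆ Var(φ)`. -/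
def EC.WF (c : EC F V) : Prop := c.bvars ⊆ c.constr.vars

/-- Free variables of an existential constraint. -/
def EC.fvars (c : EC F V) : Set V := c.constr.vars \ c.bvars

/-- `⟨∃x⃗. φ⟩` holds under valuation `ξ`: `φκ` holds under `ξ` for some substitution `κ`
mapping `x⃗` into `Val` (and the identity elsewhere). -/
def EC.holdsUnder (c : EC F V) (M : Model F V D) (ξ : V → D) : Prop :=
  ∃ κ : V → Term F V, (∀ x ∈ c.bvars, M.IsValueTerm (κ x)) ∧
    (∀ x ∉ c.bvars, κ x = Term.var x) ∧ M.holds ξ (c.constr.subst κ)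

/-- `⊨_M ⟨∃x⃗. φ⟩`. -/
def EC.validM (c : EC F V) (M : Model F V D) : Prop := ∀ ξ : V → D, c.holdsUnder M ξ

/-- Satisfiability of an existential constraint. -/
def EC.satisfiable (c : EC F V) (M : Model F V D) : Prop := ∃ ξ : V → D, c.holdsUnder M ξ

/-- Application of a substitution to an existential constraint acts on the free
variables only. -/
def EC.subst (c : EC F V) (σ : V → Term F V) : EC F V :=
  ⟨c.bvars, c.constr.subst (fun x => if x ∈ c.bvars then Term.var x else σ x)⟩

/-- `⊨_M ⟨∃x⃗.φ⟩ ⇔ ⟨∃y⃗.ψ⟩`. -/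
def ECIffM (M : Model F V D) (c c' : EC F V) : Prop :=
  ∀ ξ : V → D, c.holdsUnder M ξ ↔ c'.holdsUnder M ξ

/-- `σ ⊨_M ⟨∃x⃗.φ⟩`: `σ` maps the free variables into values and `(⟨∃x⃗.φ⟩)σ` is valid. -/
def SubstRespectsEC (M : Model F V D) (σ : V → Term F V) (c : EC F V) : Prop :=
  (∀ x ∈ c.fvars, M.IsValueTerm (σ x)) ∧ (c.subst σ).validM M

/-- `σ` respects the plain constraint `φ`. -/
def SubstRespects (M : Model F V D) (σ : V → Term F V) (φ : Term F V) : Prop :=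
  (∀ x ∈ φ.vars, M.IsValueTerm (σ x)) ∧ M.validC (φ.subst σ)

/-- An existentially constrained term `⟨X, s, ∃x⃗.φ⟩`. -/
structure ECTerm (F V : Type) where
  lvars : Set V
  term : Term F V
  ec : EC F V

/-- Well-formedness: `{x⃗} ⊆ Var(φ)`, `FVar(⟨∃x⃗.φ⟩) ⊆ X ⊆ Var(s)` and `{x⃗} ∩ Var(s) = ∅`. -/
def ECTerm.WF (T : ECTerm F V) : Prop :=
  T.ec.WF ∧ T.ec.fvars ⊆ T.lvars ∧ T.lvars ⊆ T.term.vars ∧ ∀ x ∈ T.ec.bvars, x ∉ T.term.vars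

/-- Satisfiability of an existentially constrained term. -/
def ECTerm.satisfiable (T : ECTerm F V) (M : Model F V D) : Prop := T.ec.satisfiable M

/-- `T` is subsumed by `T'`. -/
def SubsumedBy (M : Model F V D) (T T' : ECTerm F V) : Prop :=
  ∀ σ : V → Term F V, (∀ x ∈ T.lvars, M.IsValueTerm (σ x)) → SubstRespectsEC M σ T.ec →
    ∃ γ : V → Term F V, (∀ y ∈ T'.lvars, M.IsValueTerm (γ y)) ∧ SubstRespectsEC M γ T'.ec ∧
      T.term.subst σ = T'.term.subst γ

/-- Equivalence of existentially constrained terms. -/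
def ECEquiv (M : Model F V D) (T T' : ECTerm F V) : Prop :=
  SubsumedBy M T T' ∧ SubsumedBy M T' T

/-- An existentially constrained term is pattern-general if its term is linear in its
logical variables and contains no value. -/
def ECTerm.PatternGeneral (T : ECTerm F V) (M : Model F V D) : Prop :=
  T.term.LinearOn T.lvars ∧ T.term.ValueFree M

/-- A constrained rewrite rule `Π Z. ℓ → r [π]`. -/
structure Rule (F V : Type) where
  Z : Set V
  lhs : Term F V
  rhs : Term F V
  constr : Term F V

/-- `Var(ρ)`. -/
def Rule.vars (ρ : Rule F V) : Set V := ρ.lhs.vars ∪ ρ.rhs.vars ∪ ρ.constr.vars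

/-- `ExVar(ρ) = Var(r) \ Var(ℓ)`. -/
def Rule.exVars (ρ : Rule F V) : Set V := ρ.rhs.vars \ ρ.lhs.vars

/-- Well-formedness of a rule: `(Var(r) \ Var(ℓ)) ∪ Var(π) ⊆ Z ⊆ Var(ℓ,r,π)`. -/
def Rule.WF (ρ : Rule F V) : Prop :=
  (ρ.rhs.vars \ ρ.lhs.vars) ∪ ρ.constr.vars ⊆ ρ.Z ∧ ρ.Z ⊆ ρ.vars

/-- Left-linearity. -/
def Rule.LeftLinear (ρ : Rule F V) : Prop := ρ.lhs.Linear

/-- A rule is left-value-free if it is left-linear and no value occurs in its lhs. -/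
def Rule.LeftValueFree (ρ : Rule F V) (M : Model F V D) : Prop :=
  ρ.LeftLinear ∧ ρ.lhs.ValueFree M

/-- `ρ'` is a renamed variant of `ρ`. -/
def Rule.IsVariantOf (ρ' ρ : Rule F V) : Prop :=
  ∃ δ : V → V, Function.Bijective δ ∧
    ρ'.Z = δ '' ρ.Z ∧ ρ'.lhs = ρ.lhs.subst (fun x => Term.var (δ x)) ∧
    ρ'.rhs = ρ.rhs.subst (fun x => Term.var (δ x)) ∧
    ρ'.constr = ρ.constr.subst (fun x => Term.var (δ x))

/-- `⟨X,s,∃x⃗.φ⟩` has a `ρ`-redex at position `p` using substitution `γ`. -/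
structure RedexAt (M : Model F V D) (ρ : Rule F V) (T : ECTerm F V)
    (p : Pos) (γ : V → Term F V) : Prop where
  dom : substDom γ = ρ.lhs.vars
  matchAt : SubtermAt T.term p (ρ.lhs.subst γ)
  lvar : ∀ x ∈ ρ.lhs.vars ∩ ρ.Z, M.IsValueTerm (γ x) ∨ ∃ y ∈ T.lvars, γ x = Term.var y
  implied : ∀ ξ : V → D, T.ec.holdsUnder M ξ →
    EC.holdsUnder ⟨ρ.constr.vars \ ρ.lhs.vars, ρ.constr.subst γ⟩ M ξ

/-- A most general rewrite step at position `p` using substitution `γ`. -/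
structure MGStepData (M : Model F V D) (ρ : Rule F V) (T T' : ECTerm F V)
    (p : Pos) (γ : V → Term F V) : Prop where
  redex : RedexAt M ρ T p γ
  target : ReplaceAt T.term p (ρ.rhs.subst γ) T'.term
  cstr : T'.ec.constr = M.conj T.ec.constr (ρ.constr.subst γ)
  bnd : T'.ec.bvars = T'.ec.constr.vars \ T'.term.vars
  lv : T'.lvars = ρ.exVars ∪ (T.lvars ∩ T'.term.vars)

/-- A most general rewrite step at position `p`. -/
def MGStepAt (M : Model F V D) (ρ : Rule F V) (p : Pos) (T T' : ECTerm F V) : Prop :=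
  ∃ γ : V → Term F V, MGStepData M ρ T T' p γ

/-- A most general rewrite step. -/
def MGStep (M : Model F V D) (ρ : Rule F V) (T T' : ECTerm F V) : Prop :=
  ∃ (p : Pos) (γ : V → Term F V), MGStepData M ρ T T' p γ

/-- A non-quantified constrained term `⟨X, s, φ⟩`. -/
structure NQTerm (F V : Type) where
  lvars : Set V
  term : Term F V
  constr : Term F V

/-- Well-formedness: `Var(φ) ⊆ X ⊆ Var(φ, s)`. -/
def NQTerm.WF (T : NQTerm F V) : Prop :=
  T.constr.vars ⊆ T.lvars ∧ T.lvars ⊆ T.constr.vars ∪ T.term.vars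

/-- Satisfiability of a non-quantified constrained term. -/
def NQTerm.satisfiable (T : NQTerm F V) (M : Model F V D) : Prop :=
  ∃ ξ : V → D, M.holds ξ T.constr

/-- Subsumption of non-quantified constrained terms. -/
def NQSubsumedBy (M : Model F V D) (T T' : NQTerm F V) : Prop :=
  ∀ σ : V → Term F V, (∀ x ∈ T.lvars, M.IsValueTerm (σ x)) → SubstRespects M σ T.constr →
    ∃ γ : V → Term F V, (∀ y ∈ T'.lvars, M.IsValueTerm (γ y)) ∧ SubstRespects M γ T'.constr ∧
      T.term.subst σ = T'.term.subst γ

/-- Equivalence of non-quantified constrained terms. -/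
def NQEquiv (M : Model F V D) (T T' : NQTerm F V) : Prop :=
  NQSubsumedBy M T T' ∧ NQSubsumedBy M T' T

/-- A rewrite step on non-quantified constrained terms at position `p` using `σ`. -/
structure NQStepData (M : Model F V D) (ρ : Rule F V) (T T' : NQTerm F V)
    (p : Pos) (σ : V → Term F V) : Prop where
  fresh : Disjoint ρ.vars (T.lvars ∪ T.term.vars ∪ T.constr.vars)
  funpos : ∃ (f : F) (ts : List (Term F V)), SubtermAt T.term p (Term.app f ts)
  dom : substDom σ = ρ.vars
  matchAt : SubtermAt T.term p (ρ.lhs.subst σ)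
  zval : ∀ x ∈ ρ.Z, M.IsValueTerm (σ x) ∨ ∃ y ∈ T.lvars, σ x = Term.var y
  implied : ∀ ξ : V → D, M.holds ξ T.constr → M.holds ξ (ρ.constr.subst σ)
  target : ReplaceAt T.term p (ρ.rhs.subst σ) T'.term
  cstr : T'.constr = T.constr
  lv : T'.lvars = T.lvars ∩ (T'.term.vars ∪ T.constr.vars)

/-- A rewrite step on non-quantified constrained terms. -/
def NQStep (M : Model F V D) (ρ : Rule F V) (T T' : NQTerm F V) : Prop :=
  ∃ (p : Pos) (σ : V → Term F V), NQStepData M ρ T T' p σ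

/-- The existential removing translation `rmv`. -/
def rmv (T : ECTerm F V) : NQTerm F V := ⟨T.lvars ∪ T.ec.bvars, T.term, T.ec.constr⟩

/-- The existential extension translation `ext`. -/
def ext (T : NQTerm F V) : ECTerm F V :=
  ⟨T.lvars \ (T.constr.vars \ T.term.vars), T.term, ⟨T.constr.vars \ T.term.vars, T.constr⟩⟩

/-- Positions of `s` whose symbol is a variable of `X` or a value. -/
def PosXVal (M : Model F V D) (X : Set V) (s : Term F V) : Set Pos :=
  {p | ∃ u : Term F V, SubtermAt s p u ∧ ((∃ x ∈ X, u = Term.var x) ∨ M.IsValueSym u)}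

/-- `s'` is the bullet translation `s^{•X}` of `s`, obtained by replacing the subterms at
the positions `ps` (which enumerate `Pos_{X∪Val}(s)`) by the pairwise distinct fresh
variables `xs`. -/
structure BulletData (M : Model F V D) (X avoid : Set V) (s : Term F V)
    (ps : List Pos) (xs : List V) (s' : Term F V) : Prop where
  nodup_ps : ps.Nodup
  cover : ∀ p : Pos, p ∈ ps ↔ p ∈ PosXVal M X s
  nodup_xs : xs.Nodup
  len : xs.length = ps.length
  fresh : ∀ x ∈ xs, x ∉ avoid
  repl : ReplaceList s ps (xs.map Term.var) s'

/-- `T'` is the pattern-general translation `PG(T)` of `T` (with fresh variables chosen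
outside `avoid`). -/
def IsPG (M : Model F V D) (avoid : Set V) (T T' : ECTerm F V) : Prop :=
  ∃ (ps : List Pos) (xs : List V) (us : List (Term F V)),
    BulletData M T.lvars avoid T.term ps xs T'.term ∧
    List.Forall₂ (fun p u => SubtermAt T.term p u) ps us ∧
    T'.lvars = {x | x ∈ xs} ∧
    T'.ec.bvars = T.ec.bvars ∪ T.lvars ∧
    T'.ec.constr = M.conjFrom T.ec.constr (List.zipWith M.eqc us (xs.map Term.var))

/-- `ρh` is the left-value-free transformation `lvf(ρ)` of `ρ`. -/
def IsLVF (M : Model F V D) (ρ ρh : Rule F V) : Prop :=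
  ∃ (ps : List Pos) (xs : List V) (vs : List (Term F V)),
    ps.Nodup ∧ xs.Nodup ∧ xs.length = ps.length ∧
    (∀ p : Pos, p ∈ ps ↔ p ∈ PosXVal M (∅ : Set V) ρ.lhs) ∧
    List.Forall₂ (fun p v => SubtermAt ρ.lhs p v ∧ M.IsValueTerm v) ps vs ∧
    (∀ x ∈ xs, x ∉ ρ.vars) ∧
    ρh.Z = ρ.Z ∪ {x | x ∈ xs} ∧
    ReplaceList ρ.lhs ps (xs.map Term.var) ρh.lhs ∧
    ρh.rhs = ρ.rhs ∧
    ρh.constr = M.conjFrom ρ.constr (List.zipWith M.eqc (xs.map Term.var) vs)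

/-- A most general rewrite step with a fresh variant of some rule of the LCTRS `R`. -/
def StepR (M : Model F V D) (R : Set (Rule F V)) (T T' : ECTerm F V) : Prop :=
  ∃ ρ ∈ R, ∃ ρ' : Rule F V, ρ'.IsVariantOf ρ ∧
    Disjoint ρ'.vars (T.term.vars ∪ T.ec.constr.vars) ∧ MGStep M ρ' T T'

/-- One `∼ · →_R` step (on well-formed, satisfiable existentially constrained terms). -/
def SimStep (M : Model F V D) (R : Set (Rule F V)) (T T' : ECTerm F V) : Prop :=
  ∃ U : ECTerm F V, U.WF ∧ U.satisfiable M ∧ ECEquiv M T U ∧ StepR M R U T'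

/-- `n`-fold composition of a relation. -/
def RelPow {α : Type _} (r : α → α → Prop) : ℕ → α → α → Prop
  | 0 => fun a b => a = b
  | n + 1 => fun a c => ∃ b, r a b ∧ RelPow r n b c

theorem Term.induct {P : Term F V → Prop} (var : ∀ x, P (.var x))
    (app : ∀ f ts, (∀ t ∈ ts, P t) → P (.app f ts)) (t : Term F V) : P t :=
  match t with
  | .var x => var x
  | .app f ts => app f ts fun t _ => Term.induct var app t

@[simp]
theorem Term.subst_var (x : V) (σ : V → Term F V) : (Term.var x).subst σ = σ x := by
  simp [Term.subst]

@[simp]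
theorem Term.subst_app (f : F) (ts : List (Term F V)) (σ : V → Term F V) :
    (Term.app f ts).subst σ = .app f (ts.map (·.subst σ)) := by
  simp [Term.subst]

@[simp]
theorem Model.eval_app (M : Model F V D) (ξ : V → D) (f : F) (ts : List (Term F V)) :
    M.eval ξ (.app f ts) = M.interp f (ts.map (M.eval ξ)) := by
  simp [Model.eval]

@[simp]
theorem Term.mem_vars_var {x y : V} : x ∈ (Term.var y : Term F V).vars ↔ x = y := by
  constructor
  · rintro ⟨⟩
    rfl
  · rintro rfl
    exact .var

@[simp]
theorem Term.mem_vars_app {x : V} {f : F} {ts : List (Term F V)} :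
    x ∈ (Term.app f ts).vars ↔ ∃ t ∈ ts, x ∈ t.vars := by
  constructor
  · rintro ⟨⟩
    exact ⟨_, ‹_›, ‹_›⟩
  · rintro ⟨t, ht, hx⟩
    exact .app ht hx

theorem Term.subst_congr {t : Term F V} {σ τ : V → Term F V} (h : ∀ x ∈ t.vars, σ x = τ x) :
    t.subst σ = t.subst τ := by
  induction t using Term.induct with
  | var x => simpa using h
  | app f ts ih =>
    simp only [subst_app, app.injEq, true_and, List.map_inj_left]
    exact fun t ht => ih t ht fun x hx => h x (mem_vars_app.2 ⟨t, ht, hx⟩)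

theorem Model.holds_conj (M : Model F V D) (ξ : V → D) (φ ψ : Term F V) :
    M.holds ξ (M.conj φ ψ) ↔ M.holds ξ φ ∧ M.holds ξ ψ := by
  simp [Model.holds, Model.conj, M.and_spec]

theorem Model.holds_eqc (M : Model F V D) (ξ : V → D) (s t : Term F V) :
    M.holds ξ (M.eqc s t) ↔ M.eval ξ s = M.eval ξ t := by
  simp [Model.holds, Model.eqc, M.eq_spec]

theorem Model.subst_conj (M : Model F V D) (φ ψ : Term F V) (σ : V → Term F V) :
    (M.conj φ ψ).subst σ = M.conj (φ.subst σ) (ψ.subst σ) := by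
  simp [Model.conj]

theorem Model.subst_eqc (M : Model F V D) (s t : Term F V) (σ : V → Term F V) :
    (M.eqc s t).subst σ = M.eqc (s.subst σ) (t.subst σ) := by
  simp [Model.eqc]

theorem Model.vars_conj (M : Model F V D) (φ ψ : Term F V) :
    (M.conj φ ψ).vars = φ.vars ∪ ψ.vars := by
  ext x
  simp [Model.conj]

theorem Model.vars_eqc (M : Model F V D) (s t : Term F V) :
    (M.eqc s t).vars = s.vars ∪ t.vars := by
  ext x
  simp [Model.eqc]

theorem Model.IsValueTerm.subst_eq {M : Model F V D} {t : Term F V} (h : M.IsValueTerm t)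
    (σ : V → Term F V) : t.subst σ = t := by
  obtain ⟨v, -, rfl⟩ := h
  simp

theorem Model.IsValueTerm.vars_eq {M : Model F V D} {t : Term F V} (h : M.IsValueTerm t) :
    t.vars = ∅ := by
  obtain ⟨v, -, rfl⟩ := h
  ext x
  simp

theorem Model.conjFrom_cons (M : Model F V D) (φ ψ : Term F V) (l : List (Term F V)) :
    M.conjFrom φ (ψ :: l) = M.conjFrom (M.conj φ ψ) l := rfl

theorem Model.holds_conjFrom (M : Model F V D) (ξ : V → D) (φ : Term F V)
    (l : List (Term F V)) :
    M.holds ξ (M.conjFrom φ l) ↔ M.holds ξ φ ∧ ∀ ψ ∈ l, M.holds ξ ψ := by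
  induction l generalizing φ with
  | nil => simp [Model.conjFrom]
  | cons ψ l ih => simp [Model.conjFrom_cons, ih, M.holds_conj, and_assoc]

theorem Model.subst_conjFrom (M : Model F V D) (φ : Term F V) (l : List (Term F V))
    (σ : V → Term F V) :
    (M.conjFrom φ l).subst σ = M.conjFrom (φ.subst σ) (l.map (·.subst σ)) := by
  induction l generalizing φ with
  | nil => rfl
  | cons ψ l ih => simp [Model.conjFrom_cons, ih, M.subst_conj]

theorem Model.mem_vars_conjFrom (M : Model F V D) {x : V} {φ : Term F V}
    {l : List (Term F V)} :
    x ∈ (M.conjFrom φ l).vars ↔ x ∈ φ.vars ∨ ∃ ψ ∈ l, x ∈ ψ.vars := by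
  induction l generalizing φ with
  | nil => simp [Model.conjFrom]
  | cons ψ l ih => simp [Model.conjFrom_cons, ih, M.vars_conj, or_assoc]

/-- An equation between a value and itself. -/
def Model.TrivialEq (M : Model F V D) (ψ : Term F V) : Prop :=
  ∃ v, M.IsValueTerm v ∧ ψ = M.eqc v v

theorem Model.holds_subst_conjFrom_of_trivialEq (M : Model F V D) {l : List (Term F V)}
    (hl : ∀ ψ ∈ l, M.TrivialEq ψ) (φ : Term F V) (σ : V → Term F V) (ξ : V → D) :
    M.holds ξ ((M.conjFrom φ l).subst σ) ↔ M.holds ξ (φ.subst σ) := by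
  rw [M.subst_conjFrom, M.holds_conjFrom, and_iff_left_iff_imp]
  intro _ χ hχ
  obtain ⟨ψ, hψ, rfl⟩ := List.mem_map.1 hχ
  obtain ⟨v, -, rfl⟩ := hl ψ hψ
  rw [M.subst_eqc, M.holds_eqc]

theorem Model.vars_conjFrom_of_trivialEq (M : Model F V D) {l : List (Term F V)}
    (hl : ∀ ψ ∈ l, M.TrivialEq ψ) (φ : Term F V) : (M.conjFrom φ l).vars = φ.vars := by
  ext x
  rw [M.mem_vars_conjFrom, or_iff_left_iff_imp]
  rintro ⟨ψ, hψ, hx⟩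
  obtain ⟨v, hv, rfl⟩ := hl ψ hψ
  simp [M.vars_eqc, hv.vars_eq] at hx

theorem ReplaceAt.subst_eq {t t' u w : Term F V} {p : Pos} {σ : V → Term F V}
    (h : ReplaceAt t p u t') (hw : SubtermAt t p w) (huw : u.subst σ = w.subst σ) :
    t'.subst σ = t.subst σ := by
  induction h with
  | here => cases hw; exact huw
  | @app f ts i p u t t' hi _ ih =>
    cases hw with
    | app hi' hw =>
      obtain rfl := Option.some.inj (hi.symm.trans hi')
      simp only [Term.subst_app, Term.app.injEq, true_and, List.map_set, ih hw huw]
      obtain ⟨hlt, rfl⟩ := List.getElem?_eq_some_iff.1 hi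
      apply List.ext_getElem <;> simp +contextual [List.getElem_set]

theorem ReplaceAt.vars_eq {t t' u w : Term F V} {p : Pos}
    (h : ReplaceAt t p u t') (hw : SubtermAt t p w) (hwv : w.vars = ∅) :
    t'.vars = t.vars ∪ u.vars := by
  induction h with
  | here => cases hw; simp [hwv]
  | @app f ts i p u t t' hi _ ih =>
    cases hw with
    | app hi' hw =>
      obtain rfl := Option.some.inj (hi.symm.trans hi')
      have ih := ih hw
      obtain ⟨hlt, rfl⟩ := List.getElem?_eq_some_iff.1 hi
      ext x
      have ihx : x ∈ t'.vars ↔ x ∈ ts[i].vars ∨ x ∈ u.vars := by rw [ih]; rfl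
      simp only [Term.mem_vars_app, Set.mem_union]
      constructor
      · rintro ⟨s, hs, hx⟩
        rcases List.mem_or_eq_of_mem_set hs with hs | rfl
        · exact .inl ⟨s, hs, hx⟩
        · exact (ihx.1 hx).imp_left fun hx => ⟨_, List.getElem_mem hlt, hx⟩
      · have ht' : t' ∈ ts.set i t' := List.mem_set hlt t'
        rintro (⟨s, hs, hx⟩ | hx)
        · obtain ⟨j, hj, rfl⟩ := List.getElem_of_mem hs
          by_cases hij : i = j
          · subst hij
            exact ⟨t', ht', ihx.2 (.inl hx)⟩
          · refine ⟨ts[j], ?_, hx⟩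
            rw [← List.getElem_set_ne hij (a := t') (by simpa using hj)]
            exact List.getElem_mem _
        · exact ⟨t', ht', ihx.2 (.inr hx)⟩

theorem ReplaceAt.subtermAt_of_ne {t t' u : Term F V} {p q : Pos} {c d : F}
    (h : ReplaceAt t p u t') (hp : SubtermAt t p (.app c [])) (hq : SubtermAt t q (.app d []))
    (hne : p ≠ q) : SubtermAt t' q (.app d []) := by
  induction h generalizing q with
  | here =>
    cases hp
    cases hq with
    | refl => exact absurd rfl hne
    | app hi _ => simp at hi
  | @app f ts i p u t t' hi _ ih =>
    cases hp with
    | app hi' hp =>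
      obtain rfl := Option.some.inj (hi.symm.trans hi')
      cases hq with
      | refl => simp at hi
      | @app _ _ j s _ q hj hq =>
        by_cases hij : i = j
        · subst hij
          obtain rfl := Option.some.inj (hi.symm.trans hj)
          obtain ⟨hlt, -⟩ := List.getElem?_eq_some_iff.1 hi
          exact .app (by simp [hlt]) (ih hp hq fun h => hne (h ▸ rfl))
        · exact .app (by rw [List.getElem?_set_ne hij]; exact hj) hq

/-- Replacing values at pairwise distinct positions by variables adds exactly these variables,
and is undone by any substitution mapping each variable to the value it replaces. -/
theorem ReplaceList.vars_eq_and_subst_eq {M : Model F V D} {t t' : Term F V} {ps : List Pos}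
    {xs : List V} {vs : List (Term F V)} {σ : V → Term F V}
    (h : ReplaceList t ps (xs.map Term.var) t') (hps : ps.Nodup)
    (hvs : List.Forall₂ (fun p v => SubtermAt t p v ∧ M.IsValueTerm v) ps vs)
    (hσ : List.Forall₂ (fun x v => σ x = v) xs vs) :
    t'.vars = t.vars ∪ {x | x ∈ xs} ∧ t'.subst σ = t.subst σ := by
  induction ps generalizing t xs vs with
  | nil =>
    cases hvs
    cases hσ
    cases h
    simp
  | cons p ps ih =>
    cases hvs with | cons hv hvs =>
    cases hσ with | cons hx hσ =>
    cases h with | cons hr h =>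
    obtain ⟨hp, hps⟩ := List.nodup_cons.1 hps
    obtain ⟨hsub, hval⟩ := hv
    have hvars := hr.vars_eq hsub hval.vars_eq
    have hsubst := hr.subst_eq hsub (σ := σ) (by simp [hx, hval.subst_eq])
    have hvs' := (List.forall₂_and_left (p := fun q => p ≠ q) ps _).2
      ⟨fun q hq hpq => hp (hpq ▸ hq), hvs⟩
    obtain ⟨hV, hS⟩ := ih h hps (hvs'.imp fun q w hqw => by
      obtain ⟨hne, hqw, d, hd, rfl⟩ := hqw
      obtain ⟨c, -, rfl⟩ := hval
      exact ⟨hr.subtermAt_of_ne hsub hqw hne, d, hd, rfl⟩) hσ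
    refine ⟨?_, hS.trans hsubst⟩
    rw [hV, hvars]
    ext y
    simp [or_assoc]

theorem exists_subst_extending (γ : V → Term F V) {xs : List V} {vs : List (Term F V)}
    (hnd : xs.Nodup) (hlen : xs.length = vs.length) :
    ∃ σ : V → Term F V, List.Forall₂ (fun x v => σ x = v) xs vs ∧ ∀ x ∉ xs, σ x = γ x := by
  induction xs generalizing vs with
  | nil =>
    cases vs with
    | nil => exact ⟨γ, .nil, fun _ _ => rfl⟩
    | cons => simp at hlen
  | cons x xs ih =>
    cases vs with
    | nil => simp at hlen
    | cons v vs =>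
      obtain ⟨hx, hnd⟩ := List.nodup_cons.1 hnd
      obtain ⟨σ, hσ, hγ⟩ := ih hnd (by simpa using hlen)
      refine ⟨Function.update σ x v, .cons (by simp) ?_, fun y hy => ?_⟩
      · exact ((List.forall₂_and_left (p := fun y => x ≠ y) xs vs).2
          ⟨fun y hy hxy => hx (hxy ▸ hy), hσ⟩).imp fun y w h => by
            rw [Function.update_of_ne h.1.symm, h.2]
      · simp only [List.mem_cons, not_or] at hy
        rw [Function.update_of_ne hy.1, hγ y hy.2]

theorem trivialEq_of_mem_map_subst {M : Model F V D} {xs : List V} {vs : List (Term F V)}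
    {σ : V → Term F V} (hσ : List.Forall₂ (fun x v => σ x = v) xs vs)
    (hvs : ∀ v ∈ vs, M.IsValueTerm v) :
    ∀ ψ ∈ (List.zipWith M.eqc (xs.map Term.var) vs).map (·.subst σ), M.TrivialEq ψ := by
  induction hσ with
  | nil => simp
  | @cons x v xs vs hx _ ih =>
    simp only [List.mem_cons, forall_eq_or_imp] at hvs
    simp only [List.map_cons, List.zipWith_cons_cons, List.mem_cons, forall_eq_or_imp]
    refine ⟨⟨v, hvs.1, ?_⟩, ih hvs.2⟩
    rw [M.subst_eqc, Term.subst_var, hx, hvs.1.subst_eq]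

theorem vars_subset_of_mem_zipWith_eqc {M : Model F V D} {xs : List V} {vs : List (Term F V)}
    (hvs : ∀ v ∈ vs, M.IsValueTerm v) {ψ : Term F V}
    (hψ : ψ ∈ List.zipWith M.eqc (xs.map Term.var) vs) : ψ.vars ⊆ {x | x ∈ xs} := by
  rw [List.zipWith_map_left, ← List.map_uncurry_zip_eq_zipWith, List.mem_map] at hψ
  obtain ⟨⟨x, v⟩, hxv, rfl⟩ := hψ
  have hv := hvs v (List.of_mem_zip hxv).2
  intro y hy
  simp only [Function.uncurry_apply_pair, M.vars_eqc, hv.vars_eq, Set.union_empty,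
    Term.mem_vars_var] at hy
  exact hy ▸ (List.of_mem_zip hxv).1

theorem SubsumedBy.of_holds_iff {M : Model F V D} {T U : ECTerm F V} (hl : U.lvars = T.lvars)
    (ht : U.term = T.term) (hb : U.ec.bvars = T.ec.bvars)
    (hv : U.ec.constr.vars = T.ec.constr.vars)
    (hc : ∀ (σ : V → Term F V) (τ : V → Term F V) (ξ : V → D),
      M.holds ξ ((U.ec.constr.subst σ).subst τ) ↔ M.holds ξ ((T.ec.constr.subst σ).subst τ)) :
    SubsumedBy M T U := by
  intro σ hσ ⟨hval, hec⟩
  refine ⟨σ, hl ▸ hσ, ⟨by simpa only [EC.fvars, hb, hv] using hval, fun ξ => ?_⟩, by rw [ht]⟩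
  obtain ⟨κ, h₁, h₂, h₃⟩ := hec ξ
  refine ⟨κ, by simpa only [EC.subst, hb] using h₁, by simpa only [EC.subst, hb] using h₂, ?_⟩
  simp only [EC.subst, hb] at h₃ ⊢
  exact (hc _ _ _).2 h₃

/-- **Preservation of Generality by the Left-Value-Free Transformation.** -/
theorem lvf_preserves_generality {F V D : Type} (M : Model F V D)
    (ρ ρh : Rule F V) (T T' : ECTerm F V) (p : Pos)
    (hρ : ρ.WF) (hll : ρ.LeftLinear) (hlvf : IsLVF M ρ ρh)
    (hT : T.WF) (hsat : T.satisfiable M)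
    (hd : Disjoint ρ.vars (T.term.vars ∪ T.ec.constr.vars))
    (hdh : Disjoint ρh.vars (T.term.vars ∪ T.ec.constr.vars))
    (hstep : MGStepAt M ρ p T T') :
    ∃ U : ECTerm F V, MGStepAt M ρh p T U ∧ ECEquiv M U T' := by
  obtain ⟨γ, ⟨hdom, hmatch, hlvar, himp⟩, htgt, hcstr, hbnd, hlv⟩ := hstep
  obtain ⟨ps, xs, vs, hps, hxs, hlen, -, hvs, hfresh, hZ, hrepl, hrhs, hconstr⟩ := hlvf
  have hval : ∀ v ∈ vs, M.IsValueTerm v := by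
    intro v hv
    obtain ⟨i, hi, rfl⟩ := List.getElem_of_mem hv
    exact (hvs.get (by rw [hvs.length_eq]; exact hi) hi).2
  obtain ⟨σ, hσ, hσγ⟩ := exists_subst_extending γ hxs (hlen.trans hvs.length_eq)
  have hσval : ∀ x ∈ xs, M.IsValueTerm (σ x) := by
    intro x hx
    obtain ⟨i, hi, rfl⟩ := List.getElem_of_mem hx
    have := hσ.get hi (by rw [← hσ.length_eq]; exact hi)
    simp only [List.get_eq_getElem] at this
    exact this ▸ hval _ (List.getElem_mem _)
  have hagree : ∀ t : Term F V, t.vars ⊆ ρ.vars → t.subst σ = t.subst γ := fun t ht =>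
    Term.subst_congr fun x hx => hσγ x fun hxs => hfresh x hxs (ht hx)
  have hlsub : ρ.lhs.vars ⊆ ρ.vars := fun x hx => .inl (.inl hx)
  have hrsub : ρ.rhs.vars ⊆ ρ.vars := fun x hx => .inl (.inr hx)
  have hcsub : ρ.constr.vars ⊆ ρ.vars := fun x hx => .inr hx
  obtain ⟨hlvars, hlsubst⟩ := hrepl.vars_eq_and_subst_eq hps hvs hσ
  rw [hagree _ hlsub] at hlsubst
  have hrsubst : ρh.rhs.subst σ = ρ.rhs.subst γ := by rw [hrhs, hagree _ hrsub]
  have htriv := trivialEq_of_mem_map_subst hσ hval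
  have hcsubst : ρh.constr.subst σ = M.conjFrom (ρ.constr.subst γ)
      ((List.zipWith M.eqc (xs.map Term.var) vs).map (·.subst σ)) := by
    rw [hconstr, M.subst_conjFrom, hagree _ hcsub]
  have hex : ρh.exVars = ρ.exVars := by
    ext x
    simp only [Rule.exVars, hrhs, hlvars, Set.mem_sdiff, Set.mem_union, Set.mem_ofPred_eq, not_or]
    exact ⟨fun h => ⟨h.1, h.2.1⟩, fun h => ⟨h.1, h.2, fun hx => hfresh x hx (hrsub h.1)⟩⟩
  have hbv : ρh.constr.vars \ ρh.lhs.vars = ρ.constr.vars \ ρ.lhs.vars := by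
    ext x
    simp only [hconstr, hlvars, Set.mem_sdiff, Set.mem_union, Set.mem_ofPred_eq, not_or,
      M.mem_vars_conjFrom]
    constructor
    · rintro ⟨hx | ⟨ψ, hψ, hx⟩, hl, hxs⟩
      · exact ⟨hx, hl⟩
      · exact absurd (vars_subset_of_mem_zipWith_eqc hval hψ hx) hxs
    · exact fun h => ⟨.inl h.1, h.2, fun hx => hfresh x hx (hcsub h.1)⟩
  have hvars : (M.conj T.ec.constr (ρh.constr.subst σ)).vars = T'.ec.constr.vars := by
    rw [hcstr, M.vars_conj, M.vars_conj, hcsubst, M.vars_conjFrom_of_trivialEq htriv]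
  have hholds : ∀ (τ τ' : V → Term F V) (ξ : V → D),
      M.holds ξ (((M.conj T.ec.constr (ρh.constr.subst σ)).subst τ).subst τ') ↔
        M.holds ξ ((T'.ec.constr.subst τ).subst τ') := by
    intro τ τ' ξ
    have htriv' : ∀ ψ ∈ ((List.zipWith M.eqc (xs.map Term.var) vs).map (·.subst σ)).map
        (·.subst τ), M.TrivialEq ψ := by
      intro χ hχ
      obtain ⟨ψ, hψ, rfl⟩ := List.mem_map.1 hχ
      obtain ⟨v, hv, rfl⟩ := htriv ψ hψ
      exact ⟨v, hv, by rw [M.subst_eqc, hv.subst_eq]⟩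
    rw [hcstr, hcsubst]
    simp only [M.subst_conj, M.holds_conj]
    rw [M.subst_conjFrom _ _ τ, M.holds_subst_conjFrom_of_trivialEq htriv']
  refine ⟨⟨T'.lvars, T'.term, T'.ec.bvars, M.conj T.ec.constr (ρh.constr.subst σ)⟩,
    ⟨σ, ⟨?_, by rwa [hlsubst], ?_, ?_⟩, by rwa [hrsubst], rfl, ?_, ?_⟩, ?_, ?_⟩
  · ext x
    rw [hlvars, ← hdom]
    by_cases hx : x ∈ xs
    · obtain ⟨v, -, hv⟩ := hσval x hx
      simp [substDom, hv, hx]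
    · simp [substDom, hσγ x hx, hx]
  · rintro x ⟨hxl, hxZ⟩
    by_cases hx : x ∈ xs
    · exact .inl (hσval x hx)
    · rw [hσγ x hx]
      rw [hlvars] at hxl
      rw [hZ] at hxZ
      exact hlvar x ⟨hxl.resolve_right hx, hxZ.resolve_right hx⟩
  · intro ξ hξ
    obtain ⟨κ, h₁, h₂, h₃⟩ := himp ξ hξ
    rw [hbv, hcsubst]
    exact ⟨κ, h₁, h₂, (M.holds_subst_conjFrom_of_trivialEq htriv _ κ ξ).2 h₃⟩
  · exact hvars ▸ hbnd
  · exact hex ▸ hlv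
  · exact .of_holds_iff rfl rfl rfl hvars.symm fun τ τ' ξ => (hholds τ τ' ξ).symm
  · exact .of_holds_iff rfl rfl rfl hvars hholds

end

end LCTRS
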